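/- Let 𝕁 be an interval of the form ℝ, (α,∞) or [α,∞) and X a complex Banach space. Then the class 𝒯ℰ(𝕁,X) of totally ergodic functions satisfies: (i) the Loomis condition (L_ℰ): if φ ∈ ℰ(𝕁,X) and Δ_h φ ∈ 𝒯ℰ(𝕁,X) for all h > 0, then φ ∈ 𝒯ℰ(𝕁,X); and (ii) condition (Δ): if φ ∈ L¹_loc(𝕁,X) and Δ_h φ ∈ 𝒯ℰ(𝕁,X) for all h > 0, then φ − M_h φ ∈ 𝒯ℰ(𝕁,X) for all h > 0. -/

import Mathlib

open MeasureTheory Set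

/-- The mean `M_h φ(t) = (1/h) ∫₀^h φ(t+s) ds`. -/
noncomputable def meanM {X : Type*} [NormedAddCommGroup X] [NormedSpace ℝ X]
    (h : ℝ) (φ : ℝ → X) : ℝ → X :=
  fun t => (1 / h) • ∫ s in (0 : ℝ)..h, φ (t + s)

/-- `a` is the ergodic mean of `φ` on `𝕁`: `sup_{x∈𝕁} ‖M_T φ(x) − a‖ → 0` as `T → ∞`. -/
noncomputable def IsErgodicMean {X : Type*} [NormedAddCommGroup X] [NormedSpace ℝ X]
    (J : Set ℝ) (φ : ℝ → X) (a : X) : Prop :=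
  ∀ ε : ℝ, 0 < ε → ∃ T₀ : ℝ, ∀ T ≥ T₀, ∀ x ∈ J, ‖meanM T φ x - a‖ ≤ ε

/-- The ergodic class `ℰ(𝕁,X)`. -/
noncomputable def ergE {X : Type*} [NormedAddCommGroup X] [NormedSpace ℝ X]
    (J : Set ℝ) : Set (ℝ → X) :=
  {φ | LocallyIntegrableOn φ J ∧ ∃ a : X, IsErgodicMean J φ a}

/-- The totally ergodic class `𝒯ℰ(𝕁,X)`: `γ_ω·φ ∈ ℰ(𝕁,X)` for all `ω ∈ ℝ`,
where `γ_ω(t) = e^{iωt}`. -/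
noncomputable def totErgTE {X : Type*} [NormedAddCommGroup X] [NormedSpace ℝ X]
    [Module ℂ X] (J : Set ℝ) : Set (ℝ → X) :=
  {φ | ∀ ω : ℝ, (fun t : ℝ => Complex.exp (Complex.I * (ω : ℂ) * (t : ℂ)) • φ t) ∈ ergE J}

open Filter Topology

/-- The character `γ_ω(t) = e^{iωt}`. -/
noncomputable def osc (ω t : ℝ) : ℂ := Complex.exp (Complex.I * (ω : ℂ) * (t : ℂ))

lemma osc_add (ω s t : ℝ) : osc ω (s + t) = osc ω s * osc ω t := by
  simp only [osc, ← Complex.exp_add]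
  congr 1
  push_cast
  ring

lemma osc_neg_mul_osc_add (ω u t : ℝ) : osc ω (-u) * osc ω (t + u) = osc ω t := by
  rw [← osc_add]
  congr 1
  ring

lemma norm_osc (ω t : ℝ) : ‖osc ω t‖ = 1 := by
  rw [osc, show Complex.I * (ω : ℂ) * (t : ℂ) = ((ω * t : ℝ) : ℂ) * Complex.I by push_cast; ring]
  exact Complex.norm_exp_ofReal_mul_I _

lemma continuous_osc (ω : ℝ) : Continuous (osc ω) := by
  unfold osc
  fun_prop

lemma norm_integral_osc_le {ω : ℝ} (hω : ω ≠ 0) (T : ℝ) :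
    ‖∫ s in (0 : ℝ)..T, osc ω s‖ ≤ 2 / |ω| := by
  have hc : Complex.I * (ω : ℂ) ≠ 0 := by simp [hω]
  have h : ∫ s in (0 : ℝ)..T, osc ω s = (osc ω T - osc ω 0) / (Complex.I * ω) :=
    integral_exp_mul_complex hc
  rw [h, norm_div, norm_mul, Complex.norm_I, one_mul, Complex.norm_real, Real.norm_eq_abs]
  gcongr
  refine (norm_sub_le _ _).trans ?_
  rw [norm_osc, norm_osc]
  norm_num

section RealScalars

variable {X : Type*} [NormedAddCommGroup X] {J : Set ℝ} {φ : ℝ → X}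

lemma IsUpperSet.add_mem (hJ : IsUpperSet J) {t h : ℝ} (ht : t ∈ J) (hh : 0 ≤ h) : t + h ∈ J :=
  hJ (le_add_of_nonneg_right hh) ht

lemma exists_Ici_mem_nhdsWithin {x : ℝ} (hx : x ∈ J) :
    ∃ c ∈ J, Ici c ∈ 𝓝[J] x := by
  by_cases h : ∃ c ∈ J, c < x
  · obtain ⟨c, hc, hcx⟩ := h
    exact ⟨c, hc, mem_nhdsWithin_of_mem_nhds (Ici_mem_nhds hcx)⟩
  · push Not at h
    exact ⟨x, hx, mem_of_superset self_mem_nhdsWithin h⟩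

lemma MeasureTheory.LocallyIntegrableOn.intervalIntegrable_of_isUpperSet
    (hφ : LocallyIntegrableOn φ J) (hJ : IsUpperSet J) {a b : ℝ} (ha : a ∈ J) (hb : b ∈ J) :
    IntervalIntegrable φ volume a b := by
  rw [intervalIntegrable_iff]
  refine (hφ.integrableOn_compact_subset (t := uIcc a b) (fun x hx => ?_) isCompact_uIcc).mono_set
    uIoc_subset_uIcc
  exact hJ.ordConnected.uIcc_subset ha hb hx

lemma MeasureTheory.LocallyIntegrableOn.intervalIntegrable_shift
    (hφ : LocallyIntegrableOn φ J) (hJ : IsUpperSet J) {t T : ℝ} (ht : t ∈ J) (hT : 0 ≤ T) :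
    IntervalIntegrable (fun s => φ (t + s)) volume 0 T := by
  simpa using
    (hφ.intervalIntegrable_of_isUpperSet hJ ht (hJ.add_mem ht hT)).comp_add_left t

lemma intervalIntegrable_indicator_Ici (hφ : LocallyIntegrableOn φ J) (hJ : IsUpperSet J)
    {c : ℝ} (hc : c ∈ J) (a b : ℝ) : IntervalIntegrable ((Ici c).indicator φ) volume a b := by
  rw [intervalIntegrable_iff, IntegrableOn, integrable_indicator_iff measurableSet_Ici,
    IntegrableOn, Measure.restrict_restrict measurableSet_Ici]
  refine (hφ.integrableOn_compact_subset (t := Icc c (max a b ⊔ c)) (fun x hx => hJ hx.1 hc)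
    isCompact_Icc).mono_set ?_
  rintro x ⟨hx, hx'⟩
  exact ⟨hx, le_sup_of_le_left hx'.2⟩

variable [NormedSpace ℝ X]

lemma meanM_eq (T t : ℝ) (φ : ℝ → X) :
    meanM T φ t = (1 / T) • ∫ s in t..t + T, φ s := by
  simp [meanM]

lemma continuousOn_meanM (hφ : LocallyIntegrableOn φ J) (hJ : IsUpperSet J) {T : ℝ}
    (hT : 0 ≤ T) : ContinuousOn (meanM T φ) J := by
  intro x hx
  obtain ⟨c, hc, hcx⟩ := exists_Ici_mem_nhdsWithin hx
  have hi := intervalIntegrable_indicator_Ici hφ hJ hc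
  have hF := intervalIntegral.continuous_primitive hi 0
  have hG : Continuous fun t => (1 / T) •
      ((∫ s in (0 : ℝ)..t + T, (Ici c).indicator φ s) - ∫ s in (0 : ℝ)..t, (Ici c).indicator φ s) :=
    ((hF.comp (continuous_id.add continuous_const)).sub hF).const_smul _
  have heq : ∀ t ∈ Ici c, meanM T φ t = (1 / T) •
      ((∫ s in (0 : ℝ)..t + T, (Ici c).indicator φ s) -
        ∫ s in (0 : ℝ)..t, (Ici c).indicator φ s) := by
    intro t ht
    rw [intervalIntegral.integral_interval_sub_left (hi _ _) (hi _ _), meanM_eq]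
    congr 1
    refine intervalIntegral.integral_congr fun s hs => ?_
    rw [uIcc_of_le (by linarith)] at hs
    exact (indicator_of_mem (s := Ici c) (le_trans ht hs.1) φ).symm
  refine hG.continuousWithinAt.congr_of_eventuallyEq ?_ ?_
  · filter_upwards [hcx] with t ht using heq t ht
  · exact heq x (mem_of_mem_nhdsWithin hx hcx)

lemma locallyIntegrableOn_meanM (hφ : LocallyIntegrableOn φ J) (hJ : IsUpperSet J) {T : ℝ}
    (hT : 0 ≤ T) : LocallyIntegrableOn (meanM T φ) J :=
  (continuousOn_meanM hφ hJ hT).locallyIntegrableOn hJ.ordConnected.measurableSet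

lemma meanM_sub {ψ : ℝ → X} (hφ : LocallyIntegrableOn φ J) (hψ : LocallyIntegrableOn ψ J)
    (hJ : IsUpperSet J) {t T : ℝ} (ht : t ∈ J) (hT : 0 ≤ T) :
    meanM T (fun s => φ s - ψ s) t = meanM T φ t - meanM T ψ t := by
  simp only [meanM]
  rw [intervalIntegral.integral_sub (hφ.intervalIntegrable_shift hJ ht hT)
    (hψ.intervalIntegrable_shift hJ ht hT), smul_sub]

lemma norm_meanM_le {t T C : ℝ} (hT : 0 < T) (h : ∀ s ∈ Ioc 0 T, ‖φ (t + s)‖ ≤ C) :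
    ‖meanM T φ t‖ ≤ C := by
  have h' : ‖∫ s in (0 : ℝ)..T, φ (t + s)‖ ≤ C * |T - 0| :=
    intervalIntegral.norm_integral_le_of_norm_le_const (by rwa [uIoc_of_le hT.le])
  rw [sub_zero, abs_of_pos hT] at h'
  rw [meanM, norm_smul, Real.norm_of_nonneg (by positivity), one_div, inv_mul_le_iff₀ hT]
  linarith

lemma exists_isErgodicMean_of_cauchy [CompleteSpace X] (hJ : J.Nonempty)
    (h : ∀ ε > 0, ∃ N : ℝ, ∀ T ≥ N, ∀ T' ≥ N, ∀ x ∈ J, ∀ x' ∈ J,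
      ‖meanM T φ x - meanM T' φ x'‖ ≤ ε) :
    ∃ a, IsErgodicMean J φ a := by
  obtain ⟨x₀, hx₀⟩ := hJ
  have hc : CauchySeq fun T : ℝ => meanM T φ x₀ := by
    refine Metric.cauchySeq_iff.2 fun ε hε => ?_
    obtain ⟨N, hN⟩ := h (ε / 2) (by positivity)
    refine ⟨N, fun T hT T' hT' => ?_⟩
    rw [dist_eq_norm]
    linarith [hN T hT T' hT' x₀ hx₀ x₀ hx₀]
  obtain ⟨a, ha⟩ := cauchySeq_tendsto_of_complete hc
  refine ⟨a, fun ε hε => ?_⟩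
  obtain ⟨N, hN⟩ := h ε hε
  refine ⟨N, fun T hT x hx => ?_⟩
  refine le_of_tendsto (tendsto_const_nhds.sub ha).norm ?_
  filter_upwards [eventually_ge_atTop N] with T' hT' using hN T hT T' hT' x hx x₀ hx₀

lemma IsErgodicMean.cauchy {a : X} (h : IsErgodicMean J φ a) {ε : ℝ} (hε : 0 < ε) :
    ∃ N : ℝ, ∀ T ≥ N, ∀ T' ≥ N, ∀ x ∈ J, ∀ x' ∈ J, ‖meanM T φ x - meanM T' φ x'‖ ≤ ε := by
  obtain ⟨N, hN⟩ := h (ε / 2) (by positivity)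
  refine ⟨N, fun T hT T' hT' x hx x' hx' => ?_⟩
  have := norm_sub_le (meanM T φ x - a) (meanM T' φ x' - a)
  rw [sub_sub_sub_cancel_right] at this
  linarith [hN T hT x hx, hN T' hT' x' hx']

end RealScalars

section ComplexScalars

variable {X : Type*} [NormedAddCommGroup X] [NormedSpace ℂ X] {J : Set ℝ} {φ : ℝ → X}

lemma locallyIntegrableOn_osc_smul (hφ : LocallyIntegrableOn φ J) (ω : ℝ) :
    LocallyIntegrableOn (fun t => osc ω t • φ t) J := by
  intro x hx
  obtain ⟨s, hs, hi⟩ := hφ x hx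
  refine ⟨s, hs, ?_⟩
  exact Integrable.bdd_smul hi 1 (continuous_osc ω).aestronglyMeasurable
    (Eventually.of_forall fun t => (norm_osc ω t).le)

lemma norm_osc_smul (ω t : ℝ) (x : X) : ‖osc ω t • x‖ = ‖x‖ := by
  rw [norm_smul, norm_osc, one_mul]

/-- The twisted increment of `p` along `h`. -/
noncomputable def twistedDiff (ω h : ℝ) (p : ℝ → X) (t : ℝ) : X :=
  osc ω (-h) • p (t + h) - p t

lemma twistedDiff_add (ω a h : ℝ) (p : ℝ → X) (t : ℝ) :
    twistedDiff ω (a + h) p t =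
      twistedDiff ω h p t + osc ω (-h) • twistedDiff ω a p (t + h) := by
  simp only [twistedDiff, smul_sub, smul_smul, ← osc_add]
  rw [show -h + -a = -(a + h) by ring, show t + h + a = t + (a + h) by ring]
  abel

lemma continuousOn_twistedDiff (hJ : IsUpperSet J) {p : ℝ → X} (hp : ContinuousOn p J)
    {ω t : ℝ} (ht : t ∈ J) : ContinuousOn (fun h => twistedDiff ω h p t) (Ici 0) := by
  have h1 : ContinuousOn (fun h => p (t + h)) (Ici 0) :=
    hp.comp (by fun_prop) fun h hh => hJ.add_mem ht hh
  have h2 : Continuous fun h => osc ω (-h) := (continuous_osc ω).comp continuous_neg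
  exact (h2.continuousOn.smul h1).sub continuousOn_const

/-- If the twisted increments of a family of continuous functions are Cauchy, uniformly in the
base point, for each step `h > 0`, then they are so uniformly for `h` in bounded intervals. -/
lemma exists_forall_norm_twistedDiff_sub_le (hJ : IsUpperSet J) {P : ℝ → ℝ → X} {ω : ℝ}
    (hP : ∀ T > 0, ContinuousOn (P T) J)
    (hc : ∀ h > 0, ∀ ε > 0, ∃ N : ℝ, ∀ T ≥ N, ∀ T' ≥ N, ∀ t ∈ J, ∀ t' ∈ J,
      ‖twistedDiff ω h (P T) t - twistedDiff ω h (P T') t'‖ ≤ ε)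
    (K : ℝ) {ε : ℝ} (hε : 0 < ε) :
    ∃ N : ℝ, ∀ h ∈ Icc 0 K, ∀ T ≥ N, ∀ T' ≥ N, ∀ t ∈ J, ∀ t' ∈ J,
      ‖twistedDiff ω h (P T) t - twistedDiff ω h (P T') t'‖ ≤ ε := by
  let D (h T T' t t' : ℝ) : X := twistedDiff ω h (P T) t - twistedDiff ω h (P T') t'
  have hD : ∀ a h T T' t t', D (a + h) T T' t t' =
      D h T T' t t' + osc ω (-h) • D a T T' (t + h) (t' + h) := by
    intro a h T T' t t'
    simp only [D, twistedDiff_add ω a h, smul_sub]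
    abel
  obtain ⟨δ, hδ, N₀, hN₀⟩ : ∃ δ > 0, ∃ N : ℝ, ∀ h ∈ Icc 0 δ, ∀ T ≥ N, ∀ T' ≥ N,
      ∀ t ∈ J, ∀ t' ∈ J, ‖D h T T' t t'‖ ≤ 2 * (ε / 3) := by
    let B (n : ℕ) : Set ℝ := {x | ∀ T ≥ (n : ℝ) + 1, ∀ T' ≥ (n : ℝ) + 1, ∀ t ∈ J, ∀ t' ∈ J,
      ‖D (Real.exp x) T T' t t'‖ ≤ ε / 3}
    have hB : ∀ n, IsClosed (B n) := by
      intro n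
      simp only [B, ofPred_forall]
      refine isClosed_iInter fun T => isClosed_iInter fun hT => isClosed_iInter fun T' =>
        isClosed_iInter fun hT' => isClosed_iInter fun t => isClosed_iInter fun ht =>
        isClosed_iInter fun t' => isClosed_iInter fun ht' => ?_
      have hn : (0 : ℝ) ≤ n := n.cast_nonneg
      have hcont : ∀ T ≥ (n : ℝ) + 1, ∀ t ∈ J,
          Continuous fun x => twistedDiff ω (Real.exp x) (P T) t := fun T hT t ht =>
        (continuousOn_twistedDiff hJ (hP T (by linarith)) ht).comp_continuous Real.continuous_exp
          fun x => (Real.exp_pos x).le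
      exact isClosed_le ((hcont T hT t ht).sub (hcont T' hT' t' ht')).norm continuous_const
    have hU : ⋃ n, B n = univ := by
      refine eq_univ_of_forall fun x => mem_iUnion.2 ?_
      obtain ⟨N, hN⟩ := hc (Real.exp x) (Real.exp_pos x) (ε / 3) (by positivity)
      obtain ⟨n, hn⟩ := exists_nat_ge N
      exact ⟨n, fun T hT T' hT' => hN T (by linarith) T' (by linarith)⟩
    obtain ⟨n, x, hx⟩ := nonempty_interior_of_iUnion_of_closed hB hU
    obtain ⟨r, hr, hball⟩ := Metric.mem_nhds_iff.1 (mem_interior_iff_mem_nhds.1 hx)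
    have hmem : ∀ a ∈ Icc (Real.exp x) (Real.exp (x + r / 2)), Real.log a ∈ B n := by
      intro a ha
      have ha0 : 0 < a := (Real.exp_pos x).trans_le ha.1
      have h1 := (Real.le_log_iff_exp_le ha0).2 ha.1
      have h2 := (Real.log_le_iff_le_exp ha0).2 ha.2
      refine hball ?_
      rw [Metric.mem_ball, Real.dist_eq, abs_of_nonneg (by linarith)]
      linarith
    have hlt : Real.exp x < Real.exp (x + r / 2) := Real.exp_lt_exp.2 (by linarith)
    refine ⟨Real.exp (x + r / 2) - Real.exp x, by linarith, n + 1,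
      fun h hh T hT T' hT' t ht t' ht' => ?_⟩
    have e1 := hmem (Real.exp x) ⟨le_rfl, hlt.le⟩ T hT T' hT' _ (hJ.add_mem ht hh.1) _
      (hJ.add_mem ht' hh.1)
    have e2 := hmem (Real.exp x + h) ⟨by linarith [hh.1], by linarith [hh.2]⟩ T hT T' hT' t ht t' ht'
    rw [Real.exp_log (Real.exp_pos x)] at e1
    rw [Real.exp_log (by linarith [Real.exp_pos x, hh.1])] at e2
    rw [← sub_eq_of_eq_add (hD (Real.exp x) h T T' t t')]
    refine (norm_sub_le _ _).trans ?_
    rw [norm_osc_smul]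
    linarith
  have hpt : ∀ n : ℕ, ∃ N : ℝ, ∀ T ≥ N, ∀ T' ≥ N, ∀ t ∈ J, ∀ t' ∈ J,
      ‖D (n * δ) T T' t t'‖ ≤ ε / 3 := by
    intro n
    rcases n.eq_zero_or_pos with rfl | hn
    · refine ⟨0, fun T _ T' _ t _ t' _ => ?_⟩
      simpa [D, twistedDiff, osc] using (by positivity : 0 ≤ ε / 3)
    · exact hc (n * δ) (by positivity) (ε / 3) (by positivity)
  choose N hN using hpt
  obtain ⟨M, hM⟩ := ((Finset.range (⌊K / δ⌋₊ + 1)).image N).exists_le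
  refine ⟨max N₀ M, fun h hh T hT T' hT' t ht t' ht' => ?_⟩
  have hhδ : 0 ≤ h / δ := div_nonneg hh.1 hδ.le
  have hle : N ⌊h / δ⌋₊ ≤ M := by
    refine hM _ (Finset.mem_image_of_mem _ (Finset.mem_range.2 (Nat.lt_succ_of_le ?_)))
    exact Nat.floor_le_floor (div_le_div_of_nonneg_right hh.2 hδ.le)
  have hr0 : ⌊h / δ⌋₊ * δ ≤ h := (le_div_iff₀ hδ).1 (Nat.floor_le hhδ)
  have hr1 : h < (⌊h / δ⌋₊ + 1) * δ := (div_lt_iff₀ hδ).1 (Nat.lt_floor_add_one _)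
  set r := h - ⌊h / δ⌋₊ * δ with hr
  have hrm : r ∈ Icc 0 δ := ⟨by linarith, by linarith⟩
  have e1 := hN₀ r hrm T (le_of_max_le_left hT) T' (le_of_max_le_left hT') t ht t' ht'
  have e2 := hN ⌊h / δ⌋₊ T (hle.trans (le_of_max_le_right hT)) T'
    (hle.trans (le_of_max_le_right hT')) _ (hJ.add_mem ht hrm.1) _ (hJ.add_mem ht' hrm.1)
  change ‖D h T T' t t'‖ ≤ ε
  rw [show h = ⌊h / δ⌋₊ * δ + r by rw [hr]; ring, hD]
  refine (norm_add_le _ _).trans ?_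
  rw [norm_osc_smul]
  linarith

variable [NormedSpace ℝ X] [IsScalarTower ℝ ℂ X]

lemma meanM_osc_smul_comp_add (ω T u t : ℝ) (φ : ℝ → X) :
    meanM T (fun s => osc ω s • φ (s + u)) t =
      osc ω (-u) • meanM T (fun s => osc ω s • φ s) (t + u) := by
  simp only [meanM]
  rw [smul_comm (osc ω (-u)) (1 / T), ← intervalIntegral.integral_smul (osc ω (-u))]
  congr 1
  refine intervalIntegral.integral_congr fun s _ => ?_
  simp only [smul_smul]
  rw [show t + u + s = t + s + u by ring, osc_neg_mul_osc_add]

lemma meanM_osc_smul_meanM (hφ : LocallyIntegrableOn φ J) (hJ : IsUpperSet J) (ω : ℝ)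
    {k T t : ℝ} (hk : 0 ≤ k) (hT : 0 ≤ T) (ht : t ∈ J) :
    meanM T (fun s => osc ω s • meanM k φ s) t =
      (1 / k) • ∫ u in (0 : ℝ)..k,
        osc ω (-u) • meanM T (fun s => osc ω s • φ s) (t + u) := by
  simp only [← meanM_osc_smul_comp_add]
  simp only [meanM]
  have hint : IntegrableOn (Function.uncurry fun s u => osc ω (t + s) • φ (t + s + u))
      (uIoc 0 T ×ˢ uIoc 0 k) := by
    have h1 : Integrable ((uIoc 0 T).indicator fun s => osc ω (t + s)) := by
      rw [integrable_indicator_iff measurableSet_uIoc, ← intervalIntegrable_iff]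
      exact ((continuous_osc ω).comp (continuous_const.add continuous_id)).intervalIntegrable _ _
    have h2 : Integrable ((uIoc 0 (T + k)).indicator fun s => φ (t + s)) := by
      rw [integrable_indicator_iff measurableSet_uIoc, ← intervalIntegrable_iff]
      exact hφ.intervalIntegrable_shift hJ ht (by positivity)
    have hmp := measurePreserving_prod_add (G := ℝ) volume volume
    have h3 := h1.smul_prod h2
    have h4 := (hmp.integrable_comp h3.aestronglyMeasurable).2 h3
    refine (h4.integrableOn (s := uIoc 0 T ×ˢ uIoc 0 k)).congr_fun ?_
      (measurableSet_uIoc.prod measurableSet_uIoc)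
    rintro ⟨s, u⟩ ⟨hs, hu⟩
    have hsu : s + u ∈ uIoc 0 (T + k) := by
      simp only [uIoc_of_le, hT, hk, add_nonneg, mem_Ioc] at hs hu ⊢
      constructor <;> linarith
    simp [indicator_of_mem hs, indicator_of_mem hsu, Function.uncurry, add_assoc]
  have hsw := intervalIntegral_intervalIntegral_swap hint
  have hl : ∀ s, osc ω (t + s) • (1 / k) • ∫ u in (0 : ℝ)..k, φ (t + s + u) =
      (1 / k) • ∫ u in (0 : ℝ)..k, osc ω (t + s) • φ (t + s + u) := fun s => by
    rw [smul_comm, intervalIntegral.integral_smul]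
  simp only [hl]
  rw [intervalIntegral.integral_smul, intervalIntegral.integral_smul, hsw, smul_comm]

end ComplexScalars

section ErgodicClasses

variable {X : Type*} [NormedAddCommGroup X] [NormedSpace ℝ X] [NormedSpace ℂ X]
  [IsScalarTower ℝ ℂ X] {J : Set ℝ} {φ : ℝ → X}

lemma twistedDiff_meanM_osc_smul (hφ : LocallyIntegrableOn φ J) (hJ : IsUpperSet J) (ω : ℝ)
    {h T t : ℝ} (hh : 0 ≤ h) (hT : 0 ≤ T) (ht : t ∈ J) :
    twistedDiff ω h (meanM T fun s => osc ω s • φ s) t =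
      meanM T (fun s => osc ω s • (φ (s + h) - φ s)) t := by
  have hosc := (continuous_osc ω).comp (continuous_const.add continuous_id : Continuous (t + ·))
  have h1 : IntervalIntegrable (fun s => osc ω (t + s) • φ (t + s)) volume 0 T :=
    (hφ.intervalIntegrable_shift hJ ht hT).continuousOn_smul hosc.continuousOn
  have h2 : IntervalIntegrable (fun s => osc ω (t + s) • φ (t + s + h)) volume 0 T := by
    have := hφ.intervalIntegrable_shift hJ (hJ.add_mem ht hh) hT
    simp only [add_right_comm t h] at this
    exact this.continuousOn_smul hosc.continuousOn
  rw [twistedDiff, ← meanM_osc_smul_comp_add]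
  simp only [meanM, smul_sub]
  rw [intervalIntegral.integral_sub h2 h1, smul_sub]

variable [CompleteSpace X]

lemma meanM_osc_smul_sub_meanM (hφ : LocallyIntegrableOn φ J) (hJ : IsUpperSet J) (ω : ℝ)
    {k T t : ℝ} (hk : 0 < k) (hT : 0 ≤ T) (ht : t ∈ J) :
    meanM T (fun s => osc ω s • (φ s - meanM k φ s)) t =
      -((1 / k) • ∫ u in (0 : ℝ)..k, twistedDiff ω u (meanM T fun s => osc ω s • φ s) t) := by
  have hγφ := locallyIntegrableOn_osc_smul hφ ω
  have hcont := continuousOn_twistedDiff hJ (continuousOn_meanM hγφ hJ hT) (ω := ω) ht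
  have hi : IntervalIntegrable
      (fun u => twistedDiff ω u (meanM T fun s => osc ω s • φ s) t) volume 0 k :=
    (hcont.mono (by rw [uIcc_of_le hk.le]; exact Icc_subset_Ici_self)).intervalIntegrable
  have hadd := intervalIntegral.integral_add hi
    (intervalIntegrable_const (c := meanM T (fun s => osc ω s • φ s) t))
  simp only [twistedDiff, sub_add_cancel, intervalIntegral.integral_const, sub_zero] at hadd
  simp only [smul_sub]
  rw [meanM_sub hγφ (locallyIntegrableOn_osc_smul (locallyIntegrableOn_meanM hφ hJ hk.le) ω) hJ
    ht hT, meanM_osc_smul_meanM hφ hJ ω hk.le hT ht, hadd, smul_add, smul_smul,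
    one_div_mul_cancel hk.ne', one_smul]
  simp only [twistedDiff]
  abel

lemma cauchy_meanM_osc_smul_sub_meanM (hφ : LocallyIntegrableOn φ J) (hJ : IsUpperSet J)
    (hΔ : ∀ h : ℝ, 0 < h → (fun t => φ (t + h) - φ t) ∈ totErgTE (X := X) J)
    (ω : ℝ) {k ε : ℝ} (hk : 0 < k) (hε : 0 < ε) :
    ∃ N : ℝ, ∀ T ≥ N, ∀ T' ≥ N, ∀ t ∈ J, ∀ t' ∈ J,
      ‖meanM T (fun s => osc ω s • (φ s - meanM k φ s)) t -
        meanM T' (fun s => osc ω s • (φ s - meanM k φ s)) t'‖ ≤ ε := by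
  let P (T : ℝ) : ℝ → X := meanM T fun s => osc ω s • φ s
  have hP : ∀ T > 0, ContinuousOn (P T) J := fun T hT =>
    continuousOn_meanM (locallyIntegrableOn_osc_smul hφ ω) hJ (le_of_lt hT)
  obtain ⟨N, hN⟩ := exists_forall_norm_twistedDiff_sub_le hJ (P := P) (ω := ω) hP
    (fun h hh ε hε => by
      obtain ⟨a, ha⟩ := (hΔ h hh ω).2
      obtain ⟨N, hN⟩ := ha.cauchy hε
      refine ⟨max N 0, fun T hT T' hT' t ht t' ht' => ?_⟩
      rw [twistedDiff_meanM_osc_smul hφ hJ ω (le_of_lt hh) (le_of_max_le_right hT) ht,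
        twistedDiff_meanM_osc_smul hφ hJ ω (le_of_lt hh) (le_of_max_le_right hT') ht']
      exact hN T (le_of_max_le_left hT) T' (le_of_max_le_left hT') t ht t' ht')
    k hε
  refine ⟨max N 1, fun T hT T' hT' t ht t' ht' => ?_⟩
  have hpos : ∀ {S}, S ≥ max N 1 → 0 < S := fun h => zero_lt_one.trans_le (le_of_max_le_right h)
  have hi : ∀ {S}, S ≥ max N 1 → ∀ {x}, x ∈ J →
      IntervalIntegrable (fun u => twistedDiff ω u (P S) x) volume 0 k := fun hS _ hx =>
    ((continuousOn_twistedDiff hJ (hP _ (hpos hS)) hx).mono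
      (by rw [uIcc_of_le hk.le]; exact Icc_subset_Ici_self)).intervalIntegrable
  rw [meanM_osc_smul_sub_meanM hφ hJ ω hk (hpos hT).le ht,
    meanM_osc_smul_sub_meanM hφ hJ ω hk (hpos hT').le ht', neg_sub_neg, ← smul_sub,
    ← intervalIntegral.integral_sub (hi hT' ht') (hi hT ht), norm_smul,
    Real.norm_of_nonneg (by positivity), one_div, inv_mul_le_iff₀ hk, mul_comm]
  refine (intervalIntegral.norm_integral_le_of_norm_le_const (C := ε) fun u hu => ?_).trans
    (by rw [sub_zero, abs_of_pos hk])
  rw [uIoc_of_le hk.le] at hu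
  exact hN u (Ioc_subset_Icc_self hu) T' (le_of_max_le_left hT') T (le_of_max_le_left hT)
    t' ht' t ht

lemma norm_meanM_osc_smul_const_le {ω T t : ℝ} (hω : ω ≠ 0) (hT : 0 < T) (a : X) :
    ‖meanM T (fun s => osc ω s • a) t‖ ≤ 2 / |ω| * ‖a‖ / T := by
  have h : meanM T (fun s => osc ω s • a) t =
      (1 / T) • osc ω t • (∫ s in (0 : ℝ)..T, osc ω s) • a := by
    simp only [meanM, osc_add, mul_smul]
    rw [intervalIntegral.integral_smul, intervalIntegral.integral_smul_const]
  rw [h, norm_smul, norm_osc_smul, norm_smul, Real.norm_of_nonneg (by positivity), one_div,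
    inv_mul_le_iff₀ hT, mul_div_cancel₀ _ hT.ne']
  gcongr
  exact norm_integral_osc_le hω T

lemma norm_meanM_osc_smul_le_of_near_const {ψ : ℝ → X} (hψ : LocallyIntegrableOn ψ J)
    (hJ : IsUpperSet J) {ω T t ε : ℝ} (hω : ω ≠ 0) (hT : 0 < T) (ht : t ∈ J) {a : X}
    (ha : ∀ x ∈ J, ‖ψ x - a‖ ≤ ε) :
    ‖meanM T (fun s => osc ω s • ψ s) t‖ ≤ ε + 2 / |ω| * ‖a‖ / T := by
  have hc : LocallyIntegrableOn (fun _ : ℝ => a) J :=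
    continuous_const.continuousOn.locallyIntegrableOn hJ.ordConnected.measurableSet
  have h1 := meanM_sub (locallyIntegrableOn_osc_smul hψ ω) (locallyIntegrableOn_osc_smul hc ω) hJ
    ht hT.le
  have h2 : ‖meanM T (fun s => osc ω s • ψ s - osc ω s • a) t‖ ≤ ε :=
    norm_meanM_le hT fun s hs => by
      rw [← smul_sub, norm_osc_smul]
      exact ha _ (hJ.add_mem ht hs.1.le)
  rw [eq_add_of_sub_eq h1.symm]
  exact (norm_add_le _ _).trans (add_le_add h2 (norm_meanM_osc_smul_const_le hω hT a))

lemma sub_meanM_mem_totErgTE (hJ : IsUpperSet J) (hne : J.Nonempty)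
    (hφ : LocallyIntegrableOn φ J)
    (hΔ : ∀ h : ℝ, 0 < h → (fun t => φ (t + h) - φ t) ∈ totErgTE (X := X) J)
    {k : ℝ} (hk : 0 < k) : (fun t => φ t - meanM k φ t) ∈ totErgTE (X := X) J := fun ω =>
  ⟨locallyIntegrableOn_osc_smul (hφ.sub (locallyIntegrableOn_meanM hφ hJ hk.le)) ω,
    exists_isErgodicMean_of_cauchy hne fun _ hε =>
      cauchy_meanM_osc_smul_sub_meanM hφ hJ hΔ ω hk hε⟩

lemma mem_totErgTE_of_mem_ergE (hJ : IsUpperSet J) (hne : J.Nonempty)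
    (hφ : φ ∈ ergE (X := X) J)
    (hΔ : ∀ h : ℝ, 0 < h → (fun t => φ (t + h) - φ t) ∈ totErgTE (X := X) J) :
    φ ∈ totErgTE (X := X) J := by
  intro ω
  rcases eq_or_ne ω 0 with rfl | hω
  · simpa using hφ
  obtain ⟨hloc, a, ha⟩ := hφ
  have hγφ := locallyIntegrableOn_osc_smul hloc ω
  refine ⟨hγφ, exists_isErgodicMean_of_cauchy hne fun ε hε => ?_⟩
  obtain ⟨K₀, hK₀⟩ := ha (ε / 8) (by positivity)
  set k := max K₀ 1
  have hk : 0 < k := zero_lt_one.trans_le (le_max_right _ _)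
  have hM := locallyIntegrableOn_meanM hloc hJ hk.le
  obtain ⟨N, hN⟩ := cauchy_meanM_osc_smul_sub_meanM hloc hJ hΔ ω hk (half_pos hε)
  set C := 2 / |ω| * ‖a‖
  have hsmall : ∀ T ≥ max N (max 1 (C / (ε / 8))), ∀ t ∈ J,
      ‖meanM T (fun s => osc ω s • meanM k φ s) t‖ ≤ ε / 4 := by
    intro T hT t ht
    have hT' := le_of_max_le_right hT
    have hT0 : 0 < T := zero_lt_one.trans_le (le_of_max_le_left hT')
    have h := norm_meanM_osc_smul_le_of_near_const hM hJ hω hT0 ht (hK₀ k (le_max_left _ _))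
    have hC : C / T ≤ ε / 8 := (div_le_comm₀ (by positivity) hT0).1 (le_of_max_le_right hT')
    linarith
  have hsplit : ∀ T ≥ max N (max 1 (C / (ε / 8))), ∀ t ∈ J,
      meanM T (fun s => osc ω s • φ s) t =
        meanM T (fun s => osc ω s • (φ s - meanM k φ s)) t +
          meanM T (fun s => osc ω s • meanM k φ s) t := by
    intro T hT t ht
    have hT0 : 0 ≤ T := zero_le_one.trans (le_of_max_le_left (le_of_max_le_right hT))
    simp only [smul_sub]
    rw [meanM_sub hγφ (locallyIntegrableOn_osc_smul hM ω) hJ ht hT0, sub_add_cancel]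
  refine ⟨max N (max 1 (C / (ε / 8))), fun T hT T' hT' t ht t' ht' => ?_⟩
  change ‖meanM T (fun s => osc ω s • φ s) t - meanM T' (fun s => osc ω s • φ s) t'‖ ≤ ε
  rw [hsplit T hT t ht, hsplit T' hT' t' ht', add_sub_add_comm]
  refine (norm_add_le _ _).trans ?_
  have h1 := hN T (le_of_max_le_left hT) T' (le_of_max_le_left hT') t ht t' ht'
  have h2 := norm_sub_le (meanM T (fun s => osc ω s • meanM k φ s) t)
    (meanM T' (fun s => osc ω s • meanM k φ s) t')
  linarith [hsmall T hT t ht, hsmall T' hT' t' ht']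

end ErgodicClasses

/-- Proposition 8.9, 𝒯ℰ part.  `𝒯ℰ(𝕁,X)` satisfies the Loomis
condition `(L_ℰ)` and condition (Δ). -/
theorem prop_8_9_TE {X : Type*} [NormedAddCommGroup X] [NormedSpace ℝ X]
    [NormedSpace ℂ X] [IsScalarTower ℝ ℂ X] [CompleteSpace X]
    (J : Set ℝ)
    (hJ : J = Set.univ ∨ (∃ α : ℝ, J = Set.Ioi α) ∨ (∃ α : ℝ, J = Set.Ici α)) :
    (∀ φ ∈ ergE (X := X) J,
      (∀ h : ℝ, 0 < h → (fun t => φ (t + h) - φ t) ∈ totErgTE (X := X) J) →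
      φ ∈ totErgTE (X := X) J) ∧
    (∀ φ : ℝ → X, LocallyIntegrableOn φ J →
      (∀ h : ℝ, 0 < h → (fun t => φ (t + h) - φ t) ∈ totErgTE (X := X) J) →
      ∀ h : ℝ, 0 < h → (fun t => φ t - meanM h φ t) ∈ totErgTE (X := X) J) := by
  obtain ⟨hU, hne⟩ : IsUpperSet J ∧ J.Nonempty := by
    rcases hJ with rfl | ⟨α, rfl⟩ | ⟨α, rfl⟩
    · exact ⟨isUpperSet_univ, univ_nonempty⟩
    · exact ⟨isUpperSet_Ioi α, nonempty_Ioi⟩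
    · exact ⟨isUpperSet_Ici α, nonempty_Ici⟩
  exact ⟨fun φ hφ hΔ => mem_totErgTE_of_mem_ergE hU hne hφ hΔ,
    fun φ hφ hΔ h hh => sub_meanM_mem_totErgTE hU hne hφ hΔ hh⟩
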